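/- Suppose R and C are non-increasing and M(R,C) contains a matrix A with no checkerboard submatrix at all (equivalently, A is nested). Then M(R,C) = {A}; i.e., A is the unique (0,1)-matrix with row sums R and column sums C. -/

import Mathlib

/-- `A` has a checkerboard: a 2×2 submatrix equal to `[[1,0],[0,1]]` or `[[0,1],[1,0]]`. -/
def HasCheckerboard {p q : ℕ} (A : Matrix (Fin p) (Fin q) ℤ) : Prop :=
  ∃ (i j : Fin p) (k l : Fin q), i < j ∧ k < l ∧
    ((A i k = 1 ∧ A j l = 1 ∧ A i l = 0 ∧ A j k = 0) ∨
     (A i k = 0 ∧ A j l = 0 ∧ A i l = 1 ∧ A j k = 1))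

/-- if `R` and `C` are non-increasing and `A ∈ M(R,C)` has no
checkerboard, then `A` is the unique (0,1)-matrix with row sums `R` and column sums `C`. -/
theorem stmt19 {p q : ℕ} (A : Matrix (Fin p) (Fin q) ℤ)
    (hA : ∀ r s, A r s = 0 ∨ A r s = 1)
    (hR : Antitone (fun i : Fin p => ∑ k, A i k))
    (hC : Antitone (fun k : Fin q => ∑ i, A i k))
    (hnocb : ¬ HasCheckerboard A) :
    ∀ B : Matrix (Fin p) (Fin q) ℤ, (∀ r s, B r s = 0 ∨ B r s = 1) →
      (∀ i, ∑ k, B i k = ∑ k, A i k) → (∀ k, ∑ i, B i k = ∑ i, A i k) → B = A := by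
  intro B hB hBR hBC
  -- rows of A are nested
  have nest : ∀ i k l, k < l → A i l = 1 → A i k = 1 := by
    intro i k l hkl hl
    by_contra hne
    have hk : A i k = 0 := (hA i k).resolve_right hne
    have hlt : ∃ j, A j l < A j k := by
      by_contra hcon
      push Not at hcon
      have : ∑ j, A j k < ∑ j, A j l :=
        Finset.sum_lt_sum (fun j _ => hcon j) ⟨i, Finset.mem_univ _, by omega⟩
      exact absurd (hC hkl.le) (not_le.mpr this)
    obtain ⟨j, hj⟩ := hlt
    have h1 := hA j k
    have h2 := hA j l
    have hjk : A j k = 1 := by omega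
    have hjl : A j l = 0 := by omega
    rcases lt_trichotomy i j with h | h | h
    · exact hnocb ⟨i, j, k, l, h, hkl, Or.inr ⟨hk, hjl, hl, hjk⟩⟩
    · subst h; omega
    · exact hnocb ⟨j, i, k, l, h, hkl, Or.inl ⟨hjk, hl, hjl, hk⟩⟩
  have one : ∀ i k, A i k = 1 → ((k : ℕ) : ℤ) + 1 ≤ ∑ l, A i l := by
    intro i k hk
    have h : ∑ l, (if l ∈ Finset.Iic k then (1 : ℤ) else 0) ≤ ∑ l, A i l := by
      refine Finset.sum_le_sum fun l _ => ?_
      split_ifs with hl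
      · rcases (Finset.mem_Iic.mp hl).lt_or_eq with h | h
        · rw [nest i l k h hk]
        · rw [h, hk]
      · have := hA i l
        omega
    rw [Finset.sum_ite_mem, Finset.univ_inter] at h
    simpa using h
  have zero : ∀ i k, A i k = 0 → ∑ l, A i l ≤ ((k : ℕ) : ℤ) := by
    intro i k hk
    have h : ∑ l, A i l ≤ ∑ l, (if l ∈ Finset.Iio k then (1 : ℤ) else 0) := by
      refine Finset.sum_le_sum fun l _ => ?_
      split_ifs with hl
      · have := hA i l
        omega
      · rcases (not_lt.mp (fun h => hl (Finset.mem_Iio.mpr h))).lt_or_eq with h | h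
        · have h1 := hA i l
          have h2 := nest i k l h
          by_contra hc
          have := h2 (by omega)
          omega
        · rw [← h, hk]
    rw [Finset.sum_ite_mem, Finset.univ_inter] at h
    simpa using h
  -- weights separating the ones of A from its zeros
  let w : Fin p → Fin q → ℤ := fun i k => (2 * (∑ l, A i l) - 1) - 2 * ((k : ℕ) : ℤ)
  have hnn : ∀ i k, 0 ≤ (A i k - B i k) * w i k := by
    intro i k
    simp only [w]
    rcases hA i k with h | h <;> rcases hB i k with h' | h' <;> rw [h, h']
    · simp
    · have := zero i k h
      linarith
    · have := one i k h
      linarith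
    · simp
  have hsum : ∑ i, ∑ k, (A i k - B i k) * w i k = 0 := by
    have e1 : ∑ i, ∑ k, (A i k - B i k) * (2 * (∑ l, A i l) - 1) = 0 := by
      refine Finset.sum_eq_zero fun i _ => ?_
      rw [← Finset.sum_mul, Finset.sum_sub_distrib, hBR i, sub_self, zero_mul]
    have e2 : ∑ i, ∑ k, (A i k - B i k) * (2 * ((k : ℕ) : ℤ)) = 0 := by
      rw [Finset.sum_comm]
      refine Finset.sum_eq_zero fun k _ => ?_
      rw [← Finset.sum_mul, Finset.sum_sub_distrib, hBC k, sub_self, zero_mul]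
    simp only [w, mul_sub (A _ _ - B _ _) (2 * _ - 1) _, Finset.sum_sub_distrib, e1, e2, sub_self]
  ext i k
  have h1 := (Finset.sum_eq_zero_iff_of_nonneg
    (fun i _ => Finset.sum_nonneg fun k _ => hnn i k)).mp hsum i (Finset.mem_univ _)
  have h2 := (Finset.sum_eq_zero_iff_of_nonneg (fun k _ => hnn i k)).mp h1 k (Finset.mem_univ _)
  rcases mul_eq_zero.mp h2 with h | h
  · linarith
  · simp only [w] at h
    omega
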